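/- Let (X,d,m) be an mm-space satisfying CD(0,N) for some N ∈ (1,∞). Let A₀, A₁ ⊆ supp m be Borel sets with 0 < m(A₀) < ∞ and 0 < m(A₁) < ∞, let t ∈ [0,1], and let A_t be the set of all t-intermediate points, i.e. all z ∈ X such that d(a₀,z) = t·d(a₀,a₁) and d(z,a₁) = (1−t)·d(a₀,a₁) for some a₀ ∈ A₀ and a₁ ∈ A₁. Then m*(A_t)^{1/N} ≥ (1−t)·m(A₀)^{1/N} + t·m(A₁)^{1/N}, where m* denotes the outer measure induced by m. -/

import Mathlib

open MeasureTheory Filter Set Topology ENNReal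
open scoped Classical

noncomputable section

/-- A coupling of two measures. -/
def IsCoupling {α β : Type*} [MeasurableSpace α] [MeasurableSpace β]
    (q : Measure (α × β)) (μ : Measure α) (ν : Measure β) : Prop :=
  Measure.map Prod.fst q = μ ∧ Measure.map Prod.snd q = ν

/-- Membership in the Wasserstein space `P₂`. -/
def MemP2 {α : Type*} [MetricSpace α] [MeasurableSpace α] (μ : Measure α) : Prop :=
  IsProbabilityMeasure μ ∧ ∃ x₀ : α, ∫⁻ x, edist x x₀ ^ 2 ∂μ < ∞

/-- The squared Kantorovich–Wasserstein distance. -/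
def Wsq {α : Type*} [MetricSpace α] [MeasurableSpace α] (μ ν : Measure α) : ℝ≥0∞ :=
  ⨅ (q : Measure (α × α)) (_ : IsCoupling q μ ν), ∫⁻ p, edist p.1 p.2 ^ 2 ∂q

/-- The Kantorovich–Wasserstein distance `W₂`. -/
def W2 {α : Type*} [MetricSpace α] [MeasurableSpace α] (μ ν : Measure α) : ℝ≥0∞ :=
  Wsq μ ν ^ (1/2 : ℝ)

/-- A `W₂`-geodesic parametrized by `[0,1]`. -/
def IsW2Geodesic {α : Type*} [MetricSpace α] [MeasurableSpace α] (μ : ℝ → Measure α) : Prop :=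
  ∀ s ∈ Icc (0:ℝ) 1, ∀ t ∈ Icc (0:ℝ) 1,
    W2 (μ s) (μ t) = ENNReal.ofReal |s - t| * W2 (μ 0) (μ 1)

/-- Integrand of the Boltzmann entropy. -/
def entFun {α : Type*} [MeasurableSpace α] (μ m : Measure α) (x : α) : ℝ :=
  (μ.rnDeriv m x).toReal * Real.log (μ.rnDeriv m x).toReal

/-- Boltzmann entropy `Ent(μ|m)`. -/
def Ent {α : Type*} [MeasurableSpace α] (μ m : Measure α) : EReal :=
  if μ ≪ m ∧ Integrable (fun x => max (entFun μ m x) 0) m then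
    ((∫ x, max (entFun μ m x) 0 ∂m : ℝ) : EReal)
      - ((∫⁻ x, ENNReal.ofReal (-(entFun μ m x)) ∂m : ℝ≥0∞) : EReal)
  else ⊤

/-- The CD(K,∞) convexity inequality along some geodesic from `μ₀` to `μ₁`. -/
def CDinftyFor {α : Type*} [MetricSpace α] [MeasurableSpace α]
    (K : ℝ) (m μ₀ μ₁ : Measure α) : Prop :=
  ∃ μ : ℝ → Measure α, μ 0 = μ₀ ∧ μ 1 = μ₁ ∧ IsW2Geodesic μ ∧
    ∀ t ∈ Icc (0:ℝ) 1,
      Ent (μ t) m ≤ ((1 - t : ℝ) : EReal) * Ent μ₀ m + ((t : ℝ) : EReal) * Ent μ₁ m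
        - ((K/2 * (t * (1-t)) : ℝ) : EReal) * ((Wsq μ₀ μ₁ : ℝ≥0∞) : EReal)

/-- The curvature-dimension condition CD(K,∞). -/
def CDinfty {α : Type*} [MetricSpace α] [MeasurableSpace α] (K : ℝ) (m : Measure α) : Prop :=
  ∀ μ₀ μ₁ : Measure α, MemP2 μ₀ → MemP2 μ₁ → CDinftyFor K m μ₀ μ₁

/-- Distortion coefficients `τ^{(t)}_{K,N}(θ)`. -/
def tauCoef (K N t θ : ℝ) : ℝ≥0∞ :=
  if 0 < K then
    if Real.pi * Real.sqrt ((N-1)/K) ≤ θ then ∞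
    else ENNReal.ofReal (t ^ (1/N) *
      (Real.sin (Real.sqrt (K/(N-1)) * (t * θ)) / Real.sin (Real.sqrt (K/(N-1)) * θ)) ^ ((N-1)/N))
  else if K = 0 then ENNReal.ofReal t
  else ENNReal.ofReal (t ^ (1/N) *
      (Real.sinh (Real.sqrt (-K/(N-1)) * (t * θ)) / Real.sinh (Real.sqrt (-K/(N-1)) * θ)) ^ ((N-1)/N))

/-- The CD(K,N) inequality along some geodesic/optimal coupling from `μ₀` to `μ₁`,
with distortion coefficients `coef`. -/
def CDForWith {α : Type*} [MetricSpace α] [MeasurableSpace α]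
    (coef : ℝ → ℝ → ℝ≥0∞) (N : ℝ) (m μ₀ μ₁ : Measure α) : Prop :=
  ∃ (μ : ℝ → Measure α) (q : Measure (α × α)),
    μ 0 = μ₀ ∧ μ 1 = μ₁ ∧ IsW2Geodesic μ ∧ (∀ t ∈ Icc (0:ℝ) 1, μ t ≪ m) ∧
    IsCoupling q μ₀ μ₁ ∧ (∫⁻ p, edist p.1 p.2 ^ 2 ∂q) = Wsq μ₀ μ₁ ∧
    ∀ t ∈ Icc (0:ℝ) 1,
      ∫⁻ x, ((μ t).rnDeriv m x) ^ (1 - 1/N : ℝ) ∂m ≥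
      ∫⁻ p, coef (1-t) (dist p.1 p.2) * (μ₀.rnDeriv m p.1) ^ (-(1/N) : ℝ)
            + coef t (dist p.1 p.2) * (μ₁.rnDeriv m p.2) ^ (-(1/N) : ℝ) ∂q

def CDFor {α : Type*} [MetricSpace α] [MeasurableSpace α]
    (K N : ℝ) (m μ₀ μ₁ : Measure α) : Prop :=
  CDForWith (fun t θ => tauCoef K N t θ) N m μ₀ μ₁

/-- The curvature-dimension condition CD(K,N). -/
def CD {α : Type*} [MetricSpace α] [MeasurableSpace α] (K N : ℝ) (m : Measure α) : Prop :=
  ∀ μ₀ μ₁ : Measure α, MemP2 μ₀ → MemP2 μ₁ → μ₀ ≪ m → μ₁ ≪ m → CDFor K N m μ₀ μ₁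

/-- The support of a measure on a topological space. -/
def mmSupp {α : Type*} [TopologicalSpace α] [MeasurableSpace α] (μ : Measure α) : Set α :=
  {x | ∀ U ∈ nhds x, 0 < μ U}


open ProbabilityTheory in
lemma glue_couplings {X : Type*} [MeasurableSpace X] [StandardBorelSpace X] [Nonempty X]
    {μ₀ ν μ₁ : Measure X} [IsProbabilityMeasure ν]
    {q₁ q₂ : Measure (X × X)} (h₁ : IsCoupling q₁ μ₀ ν) (h₂ : IsCoupling q₂ ν μ₁) :
    ∃ γ : Measure (X × X × X),
      γ.map (fun p => (p.2.1, p.1)) = q₁ ∧ γ.map (fun p => (p.1, p.2.2)) = q₂ := by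
  have hf₁ : IsFiniteMeasure q₁ := ⟨by
    have : q₁ univ = ν univ := by
      rw [← h₁.2, Measure.map_apply measurable_snd MeasurableSet.univ, preimage_univ]
    rw [this]; exact measure_lt_top _ _⟩
  have hf₂ : IsFiniteMeasure q₂ := ⟨by
    have : q₂ univ = ν univ := by
      rw [← h₂.1, Measure.map_apply measurable_fst MeasurableSet.univ, preimage_univ]
    rw [this]; exact measure_lt_top _ _⟩
  set r := q₁.map Prod.swap with hr
  have hrf : r.fst = ν := by
    rw [Measure.fst, hr, Measure.map_map measurable_fst measurable_swap, ← h₁.2]; rfl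
  have hqf : q₂.fst = ν := h₂.1
  have d₁ := r.disintegrate r.condKernel
  have d₂ := q₂.disintegrate q₂.condKernel
  rw [hrf] at d₁
  rw [hqf] at d₂
  refine ⟨ν ⊗ₘ (r.condKernel ×ₖ q₂.condKernel), ?_, ?_⟩
  · have e : (ν ⊗ₘ (r.condKernel ×ₖ q₂.condKernel)).map (Prod.map id Prod.fst) = r := by
      rw [← Measure.compProd_map measurable_fst, ← Kernel.fst_eq, Kernel.fst_prod, d₁]
    have : q₁ = r.map Prod.swap := by
      rw [hr, Measure.map_map measurable_swap measurable_swap]; simp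
    refine Eq.trans ?_ ((congrArg (Measure.map Prod.swap) e).trans this.symm)
    rw [Measure.map_map measurable_swap (by fun_prop)]
    rfl
  · have e : (ν ⊗ₘ (r.condKernel ×ₖ q₂.condKernel)).map (Prod.map id Prod.snd) = q₂ := by
      rw [← Measure.compProd_map measurable_snd, ← Kernel.snd_eq, Kernel.snd_prod, d₂]
    exact e

/-- The excess function measuring the failure of `z` to be a `t`-intermediate point. -/
def excess {X : Type*} [MetricSpace X] (t : ℝ) (x y z : X) : ℝ :=
  (1 - t) * dist x z ^ 2 + t * dist z y ^ 2 - t * (1 - t) * dist x y ^ 2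

lemma excess_ge {X : Type*} [MetricSpace X] {t : ℝ} (ht : t ∈ Ioo (0:ℝ) 1) (x y z : X) :
    ((1 - t) * dist x z - t * dist z y) ^ 2
      + t * (1 - t) * (dist x z + dist z y - dist x y) ^ 2 ≤ excess t x y z := by
  obtain ⟨h0, h1⟩ := ht
  have htri := dist_triangle x z y
  have hc : 0 ≤ dist x y := dist_nonneg
  have key : excess t x y z - (((1 - t) * dist x z - t * dist z y) ^ 2
      + t * (1 - t) * (dist x z + dist z y - dist x y) ^ 2)
      = t * (1 - t) * (2 * dist x y * (dist x z + dist z y - dist x y)) := by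
    unfold excess; ring
  have : 0 ≤ t * (1 - t) * (2 * dist x y * (dist x z + dist z y - dist x y)) := by
    have := sub_nonneg.2 htri
    have := sub_pos.2 h1
    positivity
  linarith

lemma excess_nonneg {X : Type*} [MetricSpace X] {t : ℝ} (ht : t ∈ Ioo (0:ℝ) 1) (x y z : X) :
    0 ≤ excess t x y z := by
  refine le_trans ?_ (excess_ge ht x y z)
  have := sub_pos.2 ht.2
  have := ht.1
  positivity

lemma excess_eq_zero {X : Type*} [MetricSpace X] {t : ℝ} (ht : t ∈ Ioo (0:ℝ) 1) {x y z : X}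
    (h : excess t x y z ≤ 0) :
    dist x z = t * dist x y ∧ dist z y = (1 - t) * dist x y := by
  have h2 := excess_ge ht x y z
  have hp : 0 < t * (1 - t) := mul_pos ht.1 (sub_pos.2 ht.2)
  have ha : 0 ≤ ((1 - t) * dist x z - t * dist z y) ^ 2 := sq_nonneg _
  have hb : 0 ≤ t * (1 - t) * (dist x z + dist z y - dist x y) ^ 2 :=
    mul_nonneg hp.le (sq_nonneg _)
  have ha' : (1 - t) * dist x z - t * dist z y = 0 := by
    apply pow_eq_zero_iff (two_ne_zero) |>.1; linarith
  have hb' : dist x z + dist z y - dist x y = 0 := by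
    have : t * (1 - t) * (dist x z + dist z y - dist x y) ^ 2 = 0 := by linarith
    rcases mul_eq_zero.1 this with h | h
    · exact absurd h hp.ne'
    · exact pow_eq_zero_iff (two_ne_zero) |>.1 h
  constructor
  · linear_combination ha' + t * hb'
  · linear_combination -ha' + (1 - t) * hb'

lemma excess_add {X : Type*} [MetricSpace X] {t : ℝ} (ht : t ∈ Ioo (0:ℝ) 1) (x y z : X) :
    ENNReal.ofReal (excess t x y z)
        + ENNReal.ofReal (t * (1 - t)) * edist x y ^ 2 =
      ENNReal.ofReal (1 - t) * edist x z ^ 2 + ENNReal.ofReal t * edist z y ^ 2 := by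
  have h0 := ht.1.le
  have h1 : 0 ≤ 1 - t := sub_nonneg.2 ht.2.le
  have he := excess_nonneg ht x y z
  simp only [edist_dist]
  rw [← ENNReal.ofReal_pow dist_nonneg, ← ENNReal.ofReal_pow dist_nonneg,
    ← ENNReal.ofReal_pow dist_nonneg, ← ENNReal.ofReal_mul (by positivity),
    ← ENNReal.ofReal_mul (by positivity), ← ENNReal.ofReal_mul (by positivity),
    ← ENNReal.ofReal_add he (by positivity),
    ← ENNReal.ofReal_add (by positivity) (by positivity)]
  congr 1
  unfold excess; ring

/-- Infimum of the excess over `K₀ × K₁`. -/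
def infExcess {X : Type*} [MetricSpace X] (t : ℝ) (K₀ K₁ : Set X) (z : X) : ℝ≥0∞ :=
  ⨅ x ∈ K₀, ⨅ y ∈ K₁, ENNReal.ofReal (excess t x y z)

lemma measurable_infExcess {X : Type*} [MetricSpace X] [MeasurableSpace X] [BorelSpace X]
    (t : ℝ) (K₀ K₁ : Set X) : Measurable (infExcess t K₀ K₁) := by
  apply UpperSemicontinuous.measurable
  refine upperSemicontinuous_biInf fun x _ => upperSemicontinuous_biInf fun y _ => ?_
  apply Continuous.upperSemicontinuous
  apply ENNReal.continuous_ofReal.comp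
  unfold excess
  fun_prop

lemma infExcess_zero {X : Type*} [MetricSpace X] {t : ℝ} (ht : t ∈ Ioo (0:ℝ) 1)
    {K₀ K₁ : Set X} (hK₀ : IsCompact K₀) (hK₁ : IsCompact K₁) (hn₀ : K₀.Nonempty)
    (hn₁ : K₁.Nonempty) {z : X} (hz : infExcess t K₀ K₁ z = 0) :
    ∃ a₀ ∈ K₀, ∃ a₁ ∈ K₁, dist a₀ z = t * dist a₀ a₁ ∧ dist z a₁ = (1 - t) * dist a₀ a₁ := by
  obtain ⟨⟨x, y⟩, ⟨hx, hy⟩, hmin⟩ := (hK₀.prod hK₁).exists_isMinOn (hn₀.prod hn₁)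
    (f := fun p : X × X => excess t p.1 p.2 z) (by unfold excess; fun_prop)
  refine ⟨x, hx, y, hy, excess_eq_zero ht ?_⟩
  rw [← ENNReal.ofReal_eq_zero, ← nonpos_iff_eq_zero, ← hz]
  refine le_iInf₂ fun x' hx' => le_iInf₂ fun y' hy' => ?_
  exact ENNReal.ofReal_le_ofReal (hmin (show (x', y') ∈ K₀ ×ˢ K₁ from ⟨hx', hy'⟩))

lemma coupling_prob {X : Type*} [MeasurableSpace X] {μ ν : Measure X} [IsProbabilityMeasure μ]
    {q : Measure (X × X)} (h : IsCoupling q μ ν) : IsProbabilityMeasure ν := by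
  constructor
  rw [← h.2, Measure.map_apply measurable_snd MeasurableSet.univ, preimage_univ,
    ← preimage_univ (f := Prod.fst), ← Measure.map_apply measurable_fst MeasurableSet.univ, h.1]
  exact measure_univ

lemma exists_coupling_of_lt {X : Type*} [MetricSpace X] [MeasurableSpace X] {μ ν : Measure X}
    {c : ℝ≥0∞} (h : Wsq μ ν < c) :
    ∃ q, IsCoupling q μ ν ∧ ∫⁻ p, edist p.1 p.2 ^ 2 ∂q < c := by
  unfold Wsq at h
  obtain ⟨q, hq⟩ := iInf_lt_iff.1 h
  obtain ⟨hc, hq⟩ := iInf_lt_iff.1 hq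
  exact ⟨q, hc, hq⟩

lemma Wsq_le {X : Type*} [MetricSpace X] [MeasurableSpace X] {μ ν : Measure X}
    {q : Measure (X × X)} (h : IsCoupling q μ ν) : Wsq μ ν ≤ ∫⁻ p, edist p.1 p.2 ^ 2 ∂q := by
  unfold Wsq
  exact iInf₂_le q h

/-- Main estimate along glued couplings. -/
lemma infExcess_estimate {X : Type*} [MetricSpace X] [CompleteSpace X]
    [SecondCountableTopology X]
    [MeasurableSpace X] [BorelSpace X] {t : ℝ} (ht : t ∈ Ioo (0:ℝ) 1)
    {K₀ K₁ : Set X} (hK₀ : MeasurableSet K₀) (hK₁ : MeasurableSet K₁) {μ₀ ν μ₁ : Measure X}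
    [IsProbabilityMeasure ν] (hμ₀ : ∀ᵐ x ∂μ₀, x ∈ K₀) (hμ₁ : ∀ᵐ x ∂μ₁, x ∈ K₁)
    {q₁ q₂ : Measure (X × X)} (h₁ : IsCoupling q₁ μ₀ ν) (h₂ : IsCoupling q₂ ν μ₁) :
    ∫⁻ z, infExcess t K₀ K₁ z ∂ν + ENNReal.ofReal (t * (1 - t)) * Wsq μ₀ μ₁ ≤
      ENNReal.ofReal (1 - t) * ∫⁻ p, edist p.1 p.2 ^ 2 ∂q₁
        + ENNReal.ofReal t * ∫⁻ p, edist p.1 p.2 ^ 2 ∂q₂ := by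
  have : Nonempty X := nonempty_of_isProbabilityMeasure ν
  obtain ⟨γ, g₁, g₂⟩ := glue_couplings h₁ h₂
  have e0 : γ.map (fun p => p.2.1) = μ₀ := by
    rw [← h₁.1, ← g₁, Measure.map_map (by fun_prop) (by fun_prop)]; rfl
  have e1 : γ.map (fun p => p.2.2) = μ₁ := by
    rw [← h₂.2, ← g₂, Measure.map_map (by fun_prop) (by fun_prop)]; rfl
  have eν : γ.map (fun p => p.1) = ν := by
    rw [← h₁.2, ← g₁, Measure.map_map (by fun_prop) (by fun_prop)]; rfl
  have a0 : ∀ᵐ p ∂γ, p.2.1 ∈ K₀ := by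
    rw [← e0] at hμ₀
    exact ae_of_ae_map (by fun_prop) hμ₀
  have a1 : ∀ᵐ p ∂γ, p.2.2 ∈ K₁ := by
    rw [← e1] at hμ₁
    exact ae_of_ae_map (by fun_prop) hμ₁
  have i1 : ∫⁻ z, infExcess t K₀ K₁ z ∂ν
      ≤ ∫⁻ p, ENNReal.ofReal (excess t p.2.1 p.2.2 p.1) ∂γ := by
    rw [← eν]
    refine (lintegral_map_le _ _).trans (lintegral_mono_ae ?_)
    filter_upwards [a0, a1] with p hp0 hp1
    exact (iInf₂_le p.2.1 hp0).trans (iInf₂_le p.2.2 hp1)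
  have i2 : Wsq μ₀ μ₁ ≤ ∫⁻ p, edist p.2.1 p.2.2 ^ 2 ∂γ := by
    have hc : IsCoupling (γ.map (fun p => (p.2.1, p.2.2))) μ₀ μ₁ := by
      constructor
      · rw [Measure.map_map (by fun_prop) (by fun_prop), ← e0]; rfl
      · rw [Measure.map_map (by fun_prop) (by fun_prop), ← e1]; rfl
    refine (Wsq_le hc).trans ?_
    exact lintegral_map_le _ _
  have m1 : Measurable fun p : X × X × X => ENNReal.ofReal (excess t p.2.1 p.2.2 p.1) := by
    unfold excess; fun_prop
  calc _ ≤ ∫⁻ p, ENNReal.ofReal (excess t p.2.1 p.2.2 p.1) ∂γ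
        + ENNReal.ofReal (t * (1 - t)) * ∫⁻ p, edist p.2.1 p.2.2 ^ 2 ∂γ := by gcongr
    _ = ∫⁻ p, (ENNReal.ofReal (1 - t) * edist p.2.1 p.1 ^ 2
          + ENNReal.ofReal t * edist p.1 p.2.2 ^ 2) ∂γ := by
        rw [← lintegral_const_mul _ (by fun_prop), ← lintegral_add_left m1]
        exact lintegral_congr fun p => excess_add ht _ _ _
    _ = _ := by
        rw [lintegral_add_left (by fun_prop), lintegral_const_mul _ (by fun_prop),
          lintegral_const_mul _ (by fun_prop), ← g₁, ← g₂,
          lintegral_map (by fun_prop) (by fun_prop), lintegral_map (by fun_prop) (by fun_prop)]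

lemma Wsq_eq {X : Type*} [MetricSpace X] [MeasurableSpace X] {a b c d : Measure X} {s : ℝ}
    (h : W2 a b = ENNReal.ofReal s * W2 c d) :
    Wsq a b = ENNReal.ofReal s ^ 2 * Wsq c d := by
  unfold W2 at h
  have := congrArg (fun u => u ^ 2) h
  simp only [mul_pow] at this
  rw [← ENNReal.rpow_natCast, ← ENNReal.rpow_mul, ← ENNReal.rpow_natCast (_ ^ (1/2 : ℝ)),
    ← ENNReal.rpow_mul] at this
  norm_num at this
  exact this

/-- Intermediate measures are concentrated on intermediate points. -/
lemma intermediate_ae {X : Type*} [MetricSpace X] [CompleteSpace X]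
    [SecondCountableTopology X]
    [MeasurableSpace X] [BorelSpace X] {t : ℝ} (ht : t ∈ Ioo (0:ℝ) 1)
    {K₀ K₁ : Set X} (hK₀ : MeasurableSet K₀) (hK₁ : MeasurableSet K₁) {μ₀ ν μ₁ : Measure X}
    [IsProbabilityMeasure μ₀] (hμ₀ : ∀ᵐ x ∂μ₀, x ∈ K₀) (hμ₁ : ∀ᵐ x ∂μ₁, x ∈ K₁)
    (hW : Wsq μ₀ μ₁ ≠ ∞)
    (h₁ : Wsq μ₀ ν = ENNReal.ofReal t ^ 2 * Wsq μ₀ μ₁)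
    (h₂ : Wsq ν μ₁ = ENNReal.ofReal (1 - t) ^ 2 * Wsq μ₀ μ₁) :
    IsProbabilityMeasure ν ∧ ∀ᵐ z ∂ν, infExcess t K₀ K₁ z = 0 := by
  have f₁ : Wsq μ₀ ν ≠ ∞ := by rw [h₁]; finiteness
  have f₂ : Wsq ν μ₁ ≠ ∞ := by rw [h₂]; finiteness
  have hν : IsProbabilityMeasure ν := by
    obtain ⟨q, hq, -⟩ := exists_coupling_of_lt f₁.lt_top
    exact coupling_prob hq
  refine ⟨hν, ?_⟩
  have h1t : 0 ≤ 1 - t := sub_nonneg.2 ht.2.le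
  have main : ∫⁻ z, infExcess t K₀ K₁ z ∂ν + ENNReal.ofReal (t * (1 - t)) * Wsq μ₀ μ₁
      ≤ 0 + ENNReal.ofReal (t * (1 - t)) * Wsq μ₀ μ₁ := by
    refine ENNReal.le_of_forall_pos_le_add fun ε hε _ => ?_
    have hε' : (ε : ℝ≥0∞) ≠ 0 := by simpa using hε.ne'
    obtain ⟨q₁, hq₁, l₁⟩ := exists_coupling_of_lt (ENNReal.lt_add_right f₁ hε')
    obtain ⟨q₂, hq₂, l₂⟩ := exists_coupling_of_lt (ENNReal.lt_add_right f₂ hε')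
    refine (infExcess_estimate ht hK₀ hK₁ hμ₀ hμ₁ hq₁ hq₂).trans ?_
    calc _ ≤ ENNReal.ofReal (1 - t) * (Wsq μ₀ ν + ε) + ENNReal.ofReal t * (Wsq ν μ₁ + ε) := by
          gcongr
      _ = (ENNReal.ofReal (1 - t) * ENNReal.ofReal t ^ 2
            + ENNReal.ofReal t * ENNReal.ofReal (1 - t) ^ 2) * Wsq μ₀ μ₁
            + (ENNReal.ofReal (1 - t) + ENNReal.ofReal t) * ε := by
          rw [h₁, h₂]; ring
      _ = _ := by
          have t0 := ht.1.le
          rw [← ENNReal.ofReal_pow t0, ← ENNReal.ofReal_pow h1t, ← ENNReal.ofReal_mul h1t,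
            ← ENNReal.ofReal_mul t0, ← ENNReal.ofReal_add (by positivity) (by positivity),
            ← ENNReal.ofReal_add h1t t0]
          have e1 : (1 - t) * t ^ 2 + t * (1 - t) ^ 2 = t * (1 - t) := by ring
          have e2 : 1 - t + t = 1 := by ring
          rw [e1, e2]; simp
  have hz := ENNReal.le_of_add_le_add_right (by finiteness) main
  exact (lintegral_eq_zero_iff (measurable_infExcess t K₀ K₁)).1 (nonpos_iff_eq_zero.1 hz)

/-- Hölder step. -/
lemma renyi_le {X : Type*} [MeasurableSpace X] {m ν : Measure X} [IsProbabilityMeasure ν]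
    {N : ℝ} (hN : 1 < N) {S : Set X} (hS : ∀ᵐ z ∂ν, z ∈ S) :
    ∫⁻ x, (ν.rnDeriv m x) ^ (1 - 1/N : ℝ) ∂m ≤ m S ^ (1/N : ℝ) := by
  have hN0 : 0 < 1 / N := by positivity
  have hN1 : 0 < 1 - 1 / N := by
    rw [sub_pos, div_lt_one (by linarith)]; exact hN
  set B := toMeasurable m S
  have hB : MeasurableSet B := measurableSet_toMeasurable m S
  have hz : ν Bᶜ = 0 := by
    refine measure_mono_null ?_ hS
    intro z hz hzS
    exact hz (subset_toMeasurable m S hzS)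
  have h0 : ∫⁻ x in Bᶜ, ν.rnDeriv m x ∂m = 0 := by
    have := Measure.setLIntegral_rnDeriv_le (μ := ν) (ν := m) Bᶜ
    rw [hz] at this
    exact nonpos_iff_eq_zero.1 this
  have h0' : ∀ᵐ x ∂m, x ∈ Bᶜ → ν.rnDeriv m x = 0 := by
    rw [lintegral_eq_zero_iff (Measure.measurable_rnDeriv _ _)] at h0
    exact (ae_restrict_iff' hB.compl).1 h0
  calc ∫⁻ x, (ν.rnDeriv m x) ^ (1 - 1/N : ℝ) ∂m
      ≤ ∫⁻ x, (ν.rnDeriv m x) ^ (1 - 1/N : ℝ) * (B.indicator 1 x) ^ (1/N : ℝ) ∂m := by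
        refine lintegral_mono_ae ?_
        filter_upwards [h0'] with x hx
        by_cases hxB : x ∈ B
        · simp [hxB]
        · rw [hx hxB, ENNReal.zero_rpow_of_pos hN1]; exact zero_le
    _ ≤ (∫⁻ x, ν.rnDeriv m x ∂m) ^ (1 - 1/N : ℝ) * (∫⁻ x, B.indicator 1 x ∂m) ^ (1/N : ℝ) :=
        ENNReal.lintegral_mul_norm_pow_le (Measure.measurable_rnDeriv _ _).aemeasurable
          (measurable_one.indicator hB).aemeasurable hN1.le hN0.le (by ring)
    _ ≤ 1 * m S ^ (1/N : ℝ) := by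
        gcongr
        · refine ENNReal.rpow_le_one ?_ hN1.le
          exact Measure.lintegral_rnDeriv_le.trans (by simp)
        · rw [lintegral_indicator_one hB, measure_toMeasurable]
    _ = _ := one_mul _

/-- Normalized restriction. -/
def unif {X : Type*} [MeasurableSpace X] (m : Measure X) (K : Set X) : Measure X :=
  (m K)⁻¹ • m.restrict K

lemma unif_prob {X : Type*} [MeasurableSpace X] {m : Measure X} {K : Set X}
    (h0 : m K ≠ 0) (h1 : m K ≠ ∞) : IsProbabilityMeasure (unif m K) := by
  constructor
  simp [unif, ENNReal.inv_mul_cancel h0 h1]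

lemma unif_ac {X : Type*} [MeasurableSpace X] (m : Measure X) (K : Set X) : unif m K ≪ m :=
  (Measure.smul_absolutelyContinuous).trans Measure.restrict_le_self.absolutelyContinuous

lemma unif_ae {X : Type*} [MeasurableSpace X] (m : Measure X) {K : Set X}
    (hK : MeasurableSet K) : ∀ᵐ x ∂(unif m K), x ∈ K :=
  Measure.smul_absolutelyContinuous.ae_le (ae_restrict_mem hK)

lemma unif_rnDeriv {X : Type*} [MeasurableSpace X] {m : Measure X} [SigmaFinite m] {K : Set X}
    (hK : MeasurableSet K) (h0 : m K ≠ 0) (h1 : m K ≠ ∞) (N : ℝ) :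
    ∀ᵐ x ∂(unif m K), ((unif m K).rnDeriv m x) ^ (-(1/N) : ℝ) = m K ^ (1/N : ℝ) := by
  have : IsFiniteMeasure (m.restrict K) := ⟨by simpa using h1.lt_top⟩
  have a := Measure.rnDeriv_smul_left_of_ne_top (m.restrict K) m (r := (m K)⁻¹) (by simpa using h0)
  have b := Measure.rnDeriv_restrict_self m hK
  filter_upwards [(unif_ac m K).ae_le a, (unif_ac m K).ae_le b, unif_ae m hK] with x ha hb hx
  change ((((m K)⁻¹ • m.restrict K).rnDeriv m) x) ^ (-(1/N) : ℝ) = _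
  rw [ha, Pi.smul_apply, hb]
  simp [hx, ENNReal.rpow_neg, ENNReal.inv_rpow]

lemma unif_memP2 {X : Type*} [MetricSpace X] [MeasurableSpace X] [BorelSpace X] {m : Measure X}
    {K : Set X} (hK : IsCompact K) (h0 : m K ≠ 0) (h1 : m K ≠ ∞) : MemP2 (unif m K) := by
  have hp := unif_prob h0 h1
  obtain ⟨x₀, hx₀⟩ := nonempty_of_measure_ne_zero h0
  refine ⟨hp, x₀, ?_⟩
  have hd : Metric.ediam K ≠ ∞ := hK.isBounded.ediam_ne_top
  calc _ ≤ ∫⁻ _, Metric.ediam K ^ 2 ∂(unif m K) := by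
        refine lintegral_mono_ae ?_
        filter_upwards [unif_ae m hK.measurableSet] with x hx
        gcongr
        exact Metric.edist_le_ediam_of_mem hx hx₀
    _ < ∞ := by simp; finiteness

lemma Wsq_unif_ne_top {X : Type*} [MetricSpace X] [SecondCountableTopology X]
    [MeasurableSpace X] [BorelSpace X] {m : Measure X}
    {K₀ K₁ : Set X} (hK₀ : IsCompact K₀) (hK₁ : IsCompact K₁)
    (h00 : m K₀ ≠ 0) (h01 : m K₀ ≠ ∞) (h10 : m K₁ ≠ 0) (h11 : m K₁ ≠ ∞) :
    Wsq (unif m K₀) (unif m K₁) ≠ ∞ := by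
  have hp0 := unif_prob h00 h01
  have hp1 := unif_prob h10 h11
  have hc : IsCoupling ((unif m K₀).prod (unif m K₁)) (unif m K₀) (unif m K₁) := by
    constructor
    · exact (Measure.fst_prod)
    · exact (Measure.snd_prod)
  have hd : Metric.ediam (K₀ ∪ K₁) ≠ ∞ := (hK₀.union hK₁).isBounded.ediam_ne_top
  refine ne_top_of_le_ne_top (b := Metric.ediam (K₀ ∪ K₁) ^ 2) (by finiteness) ?_
  refine (Wsq_le hc).trans ?_
  calc _ ≤ ∫⁻ _, Metric.ediam (K₀ ∪ K₁) ^ 2 ∂((unif m K₀).prod (unif m K₁)) := by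
        refine lintegral_mono_ae ?_
        have a0 := unif_ae m hK₀.measurableSet
        have a1 := unif_ae m hK₁.measurableSet
        rw [← hc.1] at a0
        rw [← hc.2] at a1
        filter_upwards [ae_of_ae_map (by fun_prop) a0, ae_of_ae_map (by fun_prop) a1]
          with p hp0 hp1
        gcongr
        exact Metric.edist_le_ediam_of_mem (Or.inl hp0) (Or.inr hp1)
    _ = _ := by simp

/-- Brunn–Minkowski for compact sets. -/
lemma bm_compact {X : Type*} [MetricSpace X] [CompleteSpace X] [SecondCountableTopology X]
    [MeasurableSpace X] [BorelSpace X] (m : Measure X) [IsLocallyFiniteMeasure m]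
    (N : ℝ) (hN : 1 < N) (hCD : CD 0 N m) {K₀ K₁ : Set X}
    (hK₀ : IsCompact K₀) (hK₁ : IsCompact K₁)
    (h00 : m K₀ ≠ 0) (h10 : m K₁ ≠ 0) {t : ℝ} (ht : t ∈ Ioo (0:ℝ) 1) :
    ENNReal.ofReal (1 - t) * m K₀ ^ (1/N : ℝ) + ENNReal.ofReal t * m K₁ ^ (1/N : ℝ) ≤
    (m {z : X | ∃ a₀ ∈ K₀, ∃ a₁ ∈ K₁,
        dist a₀ z = t * dist a₀ a₁ ∧ dist z a₁ = (1 - t) * dist a₀ a₁}) ^ (1/N : ℝ) := by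
  have h01 : m K₀ ≠ ∞ := hK₀.measure_lt_top.ne
  have h11 : m K₁ ≠ ∞ := hK₁.measure_lt_top.ne
  have hp0 := unif_prob h00 h01
  have hp1 := unif_prob h10 h11
  have ht' : t ∈ Icc (0:ℝ) 1 := Ioo_subset_Icc_self ht
  obtain ⟨μ, q, e0, e1, hgeo, -, hq, -, hineq⟩ := hCD (unif m K₀) (unif m K₁)
    (unif_memP2 hK₀ h00 h01) (unif_memP2 hK₁ h10 h11) (unif_ac _ _) (unif_ac _ _)
  have w1 := Wsq_eq (hgeo 0 (by simp) t ht')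
  have w2 := Wsq_eq (hgeo t ht' 1 (by simp))
  have ab1 : |0 - t| = t := by rw [zero_sub, abs_neg, abs_of_pos ht.1]
  have ab2 : |t - 1| = 1 - t := by rw [abs_sub_comm, abs_of_pos (sub_pos.2 ht.2)]
  rw [ab1, e0, e1] at w1
  rw [ab2, e0, e1] at w2
  obtain ⟨hν, hae⟩ := intermediate_ae ht hK₀.measurableSet hK₁.measurableSet
    (unif_ae m hK₀.measurableSet) (unif_ae m hK₁.measurableSet)
    (Wsq_unif_ne_top hK₀ hK₁ h00 h01 h10 h11) w1 w2
  refine le_trans ?_ (renyi_le (ν := μ t) hN ?_)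
  · refine le_trans (le_of_eq ?_) (hineq t ht')
    have r0 := unif_rnDeriv hK₀.measurableSet h00 h01 N
    have r1 := unif_rnDeriv hK₁.measurableSet h10 h11 N
    have hqp : q univ = 1 := by
      rw [← preimage_univ (f := Prod.fst), ← Measure.map_apply measurable_fst MeasurableSet.univ,
        hq.1]
      exact measure_univ
    have s0 : ∀ᵐ p ∂q, ((unif m K₀).rnDeriv m p.1) ^ (-(1/N) : ℝ) = m K₀ ^ (1/N : ℝ) := by
      refine ae_of_ae_map (f := Prod.fst)
        (p := fun x => ((unif m K₀).rnDeriv m x) ^ (-(1/N) : ℝ) = m K₀ ^ (1/N : ℝ))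
        (by fun_prop) ?_
      rw [hq.1]; exact r0
    have s1 : ∀ᵐ p ∂q, ((unif m K₁).rnDeriv m p.2) ^ (-(1/N) : ℝ) = m K₁ ^ (1/N : ℝ) := by
      refine ae_of_ae_map (f := Prod.snd)
        (p := fun x => ((unif m K₁).rnDeriv m x) ^ (-(1/N) : ℝ) = m K₁ ^ (1/N : ℝ))
        (by fun_prop) ?_
      rw [hq.2]; exact r1
    have : ∀ᵐ p ∂q, (tauCoef 0 N (1-t) (dist p.1 p.2)
            * ((unif m K₀).rnDeriv m p.1) ^ (-(1/N) : ℝ)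
          + tauCoef 0 N t (dist p.1 p.2) * ((unif m K₁).rnDeriv m p.2) ^ (-(1/N) : ℝ))
        = ENNReal.ofReal (1 - t) * m K₀ ^ (1/N : ℝ) + ENNReal.ofReal t * m K₁ ^ (1/N : ℝ) := by
      filter_upwards [s0, s1] with p h0 h1
      rw [h0, h1]; simp [tauCoef]
    rw [lintegral_congr_ae this, lintegral_const, hqp, mul_one]
  · filter_upwards [hae] with z hz
    exact infExcess_zero ht hK₀ hK₁ (nonempty_of_measure_ne_zero h00)
      (nonempty_of_measure_ne_zero h10) hz

/-- **Brunn–Minkowski inequality** under CD(0,N). -/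
theorem brunn_minkowski
    {X : Type*} [MetricSpace X] [CompleteSpace X] [TopologicalSpace.SeparableSpace X]
    [MeasurableSpace X] [BorelSpace X] (m : Measure X) [IsLocallyFiniteMeasure m]
    (N : ℝ) (hN : 1 < N) (hCD : CD 0 N m)
    (A₀ A₁ : Set X) (hA₀s : A₀ ⊆ mmSupp m) (hA₁s : A₁ ⊆ mmSupp m)
    (hA₀ : MeasurableSet A₀) (hA₁ : MeasurableSet A₁)
    (h₀ : 0 < m A₀) (h₀' : m A₀ < ∞) (h₁ : 0 < m A₁) (h₁' : m A₁ < ∞)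
    (t : ℝ) (ht : t ∈ Icc (0:ℝ) 1) :
    (m {z : X | ∃ a₀ ∈ A₀, ∃ a₁ ∈ A₁,
        dist a₀ z = t * dist a₀ a₁ ∧ dist z a₁ = (1 - t) * dist a₀ a₁}) ^ (1/N : ℝ) ≥
      ENNReal.ofReal (1 - t) * m A₀ ^ (1/N : ℝ) + ENNReal.ofReal t * m A₁ ^ (1/N : ℝ) := by
  have := UniformSpace.secondCountable_of_separable X
  have hN0 : 0 < 1 / N := by positivity
  obtain ⟨a, ha⟩ := nonempty_of_measure_ne_zero h₀.ne'
  obtain ⟨b, hb⟩ := nonempty_of_measure_ne_zero h₁.ne'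
  rcases eq_or_lt_of_le ht.1 with rfl | ht0
  · simp only [sub_zero, ENNReal.ofReal_one, one_mul, ENNReal.ofReal_zero, zero_mul, add_zero]
    refine ENNReal.rpow_le_rpow (measure_mono fun z hz => ?_) hN0.le
    exact ⟨z, hz, b, hb, by simp, rfl⟩
  rcases eq_or_lt_of_le ht.2 with rfl | ht1
  · simp only [sub_self, ENNReal.ofReal_one, one_mul, ENNReal.ofReal_zero, zero_mul, zero_add]
    refine ENNReal.rpow_le_rpow (measure_mono fun z hz => ?_) hN0.le
    exact ⟨a, ha, z, hz, rfl, by simp⟩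
  obtain ⟨u, -, hu, hul⟩ := exists_seq_strictMono_tendsto' h₀
  obtain ⟨v, -, hv, hvl⟩ := exists_seq_strictMono_tendsto' h₁
  have lim : Tendsto (fun n => ENNReal.ofReal (1 - t) * u n ^ (1/N : ℝ)
      + ENNReal.ofReal t * v n ^ (1/N : ℝ)) atTop
      (𝓝 (ENNReal.ofReal (1 - t) * m A₀ ^ (1/N : ℝ) + ENNReal.ofReal t * m A₁ ^ (1/N : ℝ))) := by
    refine Tendsto.add ?_ ?_
    · exact ENNReal.Tendsto.const_mul (hul.ennrpow_const _) (Or.inr ENNReal.ofReal_ne_top)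
    · exact ENNReal.Tendsto.const_mul (hvl.ennrpow_const _) (Or.inr ENNReal.ofReal_ne_top)
  refine le_of_tendsto' lim fun n => ?_
  obtain ⟨K₀, hs₀, hc₀, hl₀⟩ := hA₀.exists_lt_isCompact_of_ne_top h₀'.ne (hu n).2
  obtain ⟨K₁, hs₁, hc₁, hl₁⟩ := hA₁.exists_lt_isCompact_of_ne_top h₁'.ne (hv n).2
  calc _ ≤ ENNReal.ofReal (1 - t) * m K₀ ^ (1/N : ℝ)
        + ENNReal.ofReal t * m K₁ ^ (1/N : ℝ) := by gcongr
    _ ≤ _ := bm_compact m N hN hCD hc₀ hc₁ (((hu n).1.trans hl₀).ne')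
        (((hv n).1.trans hl₁).ne') ⟨ht0, ht1⟩
    _ ≤ _ := by
        refine ENNReal.rpow_le_rpow (measure_mono ?_) hN0.le
        rintro z ⟨x, hx, y, hy, h⟩
        exact ⟨x, hs₀ hx, y, hs₁ hy, h⟩

end
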